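/- arXiv:2306.06745 — 5 statements merged into one kernel-verified Lean document; each statement's English description precedes it below -/
import Mathlib

section
/- Let X be an L-space and U a clopen upset of X. Then core U ⊆ ker U ⊆ U. -/
open Set Topology

/-- Clopen upsets of a topological space with a partial order. -/
def ClopUp (X : Type*) [TopologicalSpace X] [Preorder X] : Set (Set X) :=
  {U | IsClopen U ∧ IsUpperSet U}

/-- Downward closure of a set. -/
def downClosure (X : Type*) [Preorder X] (A : Set X) : Set X := {x | ∃ y ∈ A, x ≤ y}

/-- Priestley space: compact, and clopen upsets separate points via the Priestley separation axiom. -/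
def IsPriestley (X : Type*) [TopologicalSpace X] [Preorder X] : Prop :=
  CompactSpace X ∧ ∀ x y : X, ¬x ≤ y → ∃ U ∈ ClopUp X, x ∈ U ∧ y ∉ U

/-- Esakia space: a Priestley space in which downward closures of clopens are clopen. -/
def IsEsakia (X : Type*) [TopologicalSpace X] [Preorder X] : Prop :=
  IsPriestley X ∧ ∀ U : Set X, IsClopen U → IsClopen (downClosure X U)

/-- L-space: an extremally order-disconnected Esakia space. -/
def IsLSpace (X : Type*) [TopologicalSpace X] [Preorder X] : Prop :=
  IsEsakia X ∧ ∀ U : Set X, IsOpen U → IsUpperSet U → IsOpen (closure U)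

/-- The spatial part of an L-space: points with clopen downset. -/
def spatialPart (X : Type*) [TopologicalSpace X] [Preorder X] : Set X :=
  {y : X | IsClopen {x : X | x ≤ y}}

/-- Scott upset: a closed upset all of whose minimal points lie in the spatial part. -/
def IsScottUpset (X : Type*) [TopologicalSpace X] [Preorder X] (F : Set X) : Prop :=
  IsClosed F ∧ IsUpperSet F ∧ ∀ y ∈ F, (∀ z ∈ F, z ≤ y → z = y) → y ∈ spatialPart X

/-- Clopen Scott upsets. -/
def ClopSUp (X : Type*) [TopologicalSpace X] [Preorder X] : Set (Set X) :=
  {U | IsClopen U ∧ IsScottUpset X U}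

/-- Clopen bisets (both upsets and downsets). -/
def ClopBi (X : Type*) [TopologicalSpace X] [Preorder X] : Set (Set X) :=
  {U | IsClopen U ∧ IsUpperSet U ∧ IsLowerSet U}

/-- `V ≪ U` for clopen upsets: every open upset whose closure contains `U` contains `V`. -/
def wayBelowSet (X : Type*) [TopologicalSpace X] [Preorder X] (V U : Set X) : Prop :=
  ∀ W : Set X, IsOpen W → IsUpperSet W → U ⊆ closure W → V ⊆ W

/-- The kernel of a clopen upset. -/
def kerSet (X : Type*) [TopologicalSpace X] [Preorder X] (U : Set X) : Set X :=
  ⋃₀ {V | V ∈ ClopUp X ∧ wayBelowSet X V U}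

/-- The core of a clopen upset. -/
def coreSet (X : Type*) [TopologicalSpace X] [Preorder X] (U : Set X) : Set X :=
  ⋃₀ {V | V ∈ ClopSUp X ∧ V ⊆ U}

/-- The regular part of a clopen upset. -/
def regSet (X : Type*) [TopologicalSpace X] [Preorder X] (U : Set X) : Set X :=
  ⋃₀ {V | V ∈ ClopUp X ∧ downClosure X V ⊆ U}

/-- The center of a clopen upset. -/
def cenSet (X : Type*) [TopologicalSpace X] [Preorder X] (U : Set X) : Set X :=
  ⋃₀ {V | V ∈ ClopBi X ∧ V ⊆ U}

/-- The topology on the spatial part, generated by traces of clopen upsets. -/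
def spatialTop (X : Type*) [TopologicalSpace X] [Preorder X] :
    TopologicalSpace (spatialPart X) :=
  TopologicalSpace.generateFrom
    {V : Set (spatialPart X) | ∃ U ∈ ClopUp X, V = ((↑) : spatialPart X → X) ⁻¹' U}

/-- An algebraic L-space: the core of every clopen upset is dense in it. -/
def IsAlgebraicLSpace (X : Type*) [TopologicalSpace X] [Preorder X] : Prop :=
  IsLSpace X ∧ ∀ U ∈ ClopUp X, U ⊆ closure (coreSet X U)

/-- A space is compactly based if compact open sets form a basis. -/
def CompactlyBased (Y : Type*) [TopologicalSpace Y] : Prop :=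
  ∀ V : Set Y, IsOpen V → ∀ y ∈ V, ∃ K : Set Y, IsOpen K ∧ IsCompact K ∧ y ∈ K ∧ K ⊆ V

/-- A set is saturated if it is the intersection of the open sets containing it. -/
def IsSaturatedSet {Y : Type*} [TopologicalSpace Y] (K : Set Y) : Prop :=
  K = ⋂₀ {U : Set Y | IsOpen U ∧ K ⊆ U}

/-- The way-below relation in a frame. -/
def frameWayBelow {L : Type*} [Order.Frame L] (a b : L) : Prop :=
  ∀ S : Set L, b ≤ sSup S → ∃ T : Set L, T ⊆ S ∧ T.Finite ∧ a ≤ sSup T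

/-- A compact element of a frame. -/
def IsCompactElt {L : Type*} [Order.Frame L] (a : L) : Prop := frameWayBelow a a

/-- An algebraic frame: every element is the join of the compact elements below it. -/
def AlgebraicFrame (L : Type*) [Order.Frame L] : Prop :=
  ∀ a : L, a = sSup {k : L | IsCompactElt k ∧ k ≤ a}

/-- An arithmetic frame: algebraic with stable way-below relation. -/
def ArithmeticFrame (L : Type*) [Order.Frame L] : Prop :=
  AlgebraicFrame L ∧
    ∀ a b c : L, frameWayBelow a b → frameWayBelow a c → frameWayBelow a (b ⊓ c)

/-- A coherent frame: arithmetic and compact. -/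
def CoherentFrame (L : Type*) [Order.Frame L] : Prop :=
  ArithmeticFrame L ∧ IsCompactElt (⊤ : L)

/-- A prime filter of a frame. -/
def IsPrimeFilter {L : Type*} [Order.Frame L] (F : Set L) : Prop :=
  F.Nonempty ∧ F ≠ Set.univ ∧ (∀ a ∈ F, ∀ b : L, a ≤ b → b ∈ F) ∧
    (∀ a ∈ F, ∀ b ∈ F, a ⊓ b ∈ F) ∧ ∀ a b : L, a ⊔ b ∈ F → a ∈ F ∨ b ∈ F

/-- A completely prime filter of a frame. -/
def IsCompletelyPrimeFilter {L : Type*} [Order.Frame L] (F : Set L) : Prop :=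
  F.Nonempty ∧ F ≠ Set.univ ∧ (∀ a ∈ F, ∀ b : L, a ≤ b → b ∈ F) ∧
    (∀ a ∈ F, ∀ b ∈ F, a ⊓ b ∈ F) ∧ ∀ S : Set L, sSup S ∈ F → ∃ s ∈ S, s ∈ F

/-- The Priestley space of a frame: prime filters ordered by inclusion. -/
abbrev PriestleyDual (L : Type*) [Order.Frame L] : Type _ := {F : Set L // IsPrimeFilter F}

/-- The Priestley topology on the Priestley space of a frame. -/
instance PriestleyDual.instTopologicalSpace (L : Type*) [Order.Frame L] :
    TopologicalSpace (PriestleyDual L) :=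
  TopologicalSpace.generateFrom
    ({S : Set (PriestleyDual L) | ∃ a : L, S = {x | a ∈ x.val}} ∪
     {S : Set (PriestleyDual L) | ∃ a : L, S = {x | a ∈ x.val}ᶜ})

/-- Principal downsets of a Priestley space are closed. -/
lemma IsPriestley.isClosed_Iic {X : Type*} [TopologicalSpace X] [Preorder X]
    (hX : IsPriestley X) (z : X) : IsClosed (Iic z) := by
  rw [← isOpen_compl_iff, isOpen_iff_forall_mem_open]
  intro w hw
  obtain ⟨U, hU, hwU, hzU⟩ := hX.2 w z hw
  exact ⟨U, fun a ha haz => hzU (hU.2 haz ha), hU.1.isOpen, hwU⟩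

/-- In a Priestley space every point of a closed set lies above a minimal point of it. -/
lemma IsPriestley.exists_minimal_le {X : Type*} [TopologicalSpace X] [PartialOrder X]
    (hX : IsPriestley X) {F : Set X} (hF : IsClosed F) {x : X} (hx : x ∈ F) :
    ∃ y ≤ x, Minimal (· ∈ F) y := by
  have := hX.1
  refine zorn_le_nonempty₀ (α := Xᵒᵈ) F (fun (c : Set X) hcF hc y hy => ?_) x hx
  have hne : Nonempty c := ⟨⟨y, hy⟩⟩
  have hclosed : ∀ i : c, IsClosed (F ∩ Iic (i : X)) :=
    fun i => hF.inter (hX.isClosed_Iic _)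
  obtain ⟨z, hz⟩ := IsCompact.nonempty_iInter_of_directed_nonempty_isCompact_isClosed
    (fun i : c => F ∩ Iic (i : X))
    (fun i j => by
      rcases hc.total i.2 j.2 with (h : (j : X) ≤ i) | (h : (i : X) ≤ j)
      · exact ⟨j, inter_subset_inter_right _ (Iic_subset_Iic.2 h), subset_rfl⟩
      · exact ⟨i, subset_rfl, inter_subset_inter_right _ (Iic_subset_Iic.2 h)⟩)
    (fun i => ⟨i, hcF i.2, le_refl (i : X)⟩)
    (fun i => (hclosed i).isCompact) hclosed
  rw [mem_iInter] at hz
  exact ⟨z, (hz ⟨y, hy⟩).1, fun w hw => (hz ⟨w, hw⟩).2⟩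

/-- A Scott upset of a Priestley space contained in `U` is way below `U`. -/
lemma IsScottUpset.wayBelowSet {X : Type*} [TopologicalSpace X] [PartialOrder X]
    (hX : IsPriestley X) {U V : Set X} (hV : IsScottUpset X V) (hVU : V ⊆ U) :
    wayBelowSet X V U := by
  intro W _ hW hUW x hx
  obtain ⟨y, hyx, hy⟩ := hX.exists_minimal_le hV.1 hx
  have hyY : y ∈ spatialPart X :=
    hV.2.2 y hy.prop fun z hz hzy => hy.eq_of_le hz hzy
  obtain ⟨z, hzy, hzW⟩ :=
    mem_closure_iff.1 (hUW (hVU hy.prop)) {x | x ≤ y} (IsClopen.isOpen hyY) (le_refl y)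
  exact hW (le_trans hzy hyx) hzW

/-- core U ⊆ ker U ⊆ U for a clopen upset U of an L-space. -/
theorem stmt0 {X : Type*} [TopologicalSpace X] [PartialOrder X]
    (hX : IsLSpace X) (U : Set X) (hU : U ∈ ClopUp X) :
    coreSet X U ⊆ kerSet X U ∧ kerSet X U ⊆ U := by
  refine ⟨?_, sUnion_subset fun V hV => hV.2 U hU.1.isOpen hU.2 subset_closure⟩
  rintro x ⟨V, ⟨⟨hVc, hVS⟩, hVU⟩, hx⟩
  exact ⟨V, ⟨⟨hVc, hVS.2.1⟩, hVS.wayBelowSet hX.1.1 hVU⟩, hx⟩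
end

section
/- Let X be an L-space and U a clopen upset of X. Then U is a Scott upset if and only if core U = U. -/
open Set Topology

/-- a clopen upset is a Scott upset iff it equals its core. -/
theorem stmt1 {X : Type*} [TopologicalSpace X] [PartialOrder X]
    (hX : IsLSpace X) (U : Set X) (hU : U ∈ ClopUp X) :
    IsScottUpset X U ↔ coreSet X U = U := by
  constructor
  · intro h
    exact Subset.antisymm (sUnion_subset fun V hV => hV.2)
      (subset_sUnion_of_mem ⟨⟨hU.1, h⟩, Subset.rfl⟩)
  · intro h
    refine ⟨hU.1.isClosed, hU.2, fun y hy hmin => ?_⟩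
    obtain ⟨V, ⟨hV, hVU⟩, hyV⟩ : y ∈ coreSet X U := h.symm ▸ hy
    exact hV.2.2.2 y hyV fun z hz hzy => hmin z (hVU hz) hzy
end

section
/- Let L be a frame and X_L its Priestley space, with spatial part Y = {y ∈ X_L : ↓y is clopen}, Scott upsets, and core defined as for L-spaces. Then L is an algebraic frame if and only if for every clopen upset U of X_L, core U is dense in U. -/
open Set Topology

namespace IsPrimeFilter

variable {L : Type*} [Order.Frame L] {F : Set L}

theorem mem_of_le (hF : IsPrimeFilter F) {a b : L} (ha : a ∈ F) (hab : a ≤ b) : b ∈ F :=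
  hF.2.2.1 a ha b hab

theorem top_mem (hF : IsPrimeFilter F) : ⊤ ∈ F :=
  let ⟨_, ha⟩ := hF.1
  hF.mem_of_le ha le_top

theorem bot_notMem (hF : IsPrimeFilter F) : ⊥ ∉ F := fun h =>
  hF.2.1 (eq_univ_of_forall fun _ => hF.mem_of_le h bot_le)

theorem inf_mem_iff (hF : IsPrimeFilter F) {a b : L} : a ⊓ b ∈ F ↔ a ∈ F ∧ b ∈ F :=
  ⟨fun h => ⟨hF.mem_of_le h inf_le_left, hF.mem_of_le h inf_le_right⟩,
    fun h => hF.2.2.2.1 a h.1 b h.2⟩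

theorem sup_mem_iff (hF : IsPrimeFilter F) {a b : L} : a ⊔ b ∈ F ↔ a ∈ F ∨ b ∈ F :=
  ⟨hF.2.2.2.2 a b,
    fun h => h.elim (hF.mem_of_le · le_sup_left) (hF.mem_of_le · le_sup_right)⟩

theorem sSup_mem_iff_of_finite (hF : IsPrimeFilter F) {T : Set L} (hT : T.Finite) :
    sSup T ∈ F ↔ ∃ t ∈ T, t ∈ F := by
  induction T, hT using Set.Finite.induction_on with
  | empty => simpa using hF.bot_notMem
  | insert _ _ ih => rw [sSup_insert, hF.sup_mem_iff, ih, exists_mem_insert]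

/-- The complement of a prime filter, as an ideal. -/
def complIdeal (hF : IsPrimeFilter F) : Order.Ideal L where
  carrier := Fᶜ
  lower' := fun _ _ hba ha hb => ha (hF.mem_of_le hb hba)
  nonempty' := ⟨⊥, hF.bot_notMem⟩
  directed' := fun a ha b hb =>
    ⟨a ⊔ b, fun h => (hF.sup_mem_iff.1 h).elim ha hb, le_sup_left, le_sup_right⟩

/-- A nonempty chain of prime filters has a prime filter as its intersection. -/
theorem sInter_of_isChain {c : Set (Set L)} (hc : ∀ G ∈ c, IsPrimeFilter G)
    (hchain : IsChain (· ⊆ ·) c) (hne : c.Nonempty) : IsPrimeFilter (⋂₀ c) := by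
  obtain ⟨G₀, hG₀⟩ := hne
  refine ⟨⟨⊤, fun G hG => (hc G hG).top_mem⟩, fun h => ?_, fun a ha b hab G hG => ?_,
    fun a ha b hb G hG => ?_, fun a b hab => ?_⟩
  · exact (hc G₀ hG₀).bot_notMem ((h ▸ mem_univ (⊥ : L) : ⊥ ∈ ⋂₀ c) G₀ hG₀)
  · exact (hc G hG).mem_of_le (ha G hG) hab
  · exact (hc G hG).inf_mem_iff.2 ⟨ha G hG, hb G hG⟩
  · by_contra! h
    obtain ⟨⟨G, hG, haG⟩, ⟨H, hH, hbH⟩⟩ :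
        (∃ G ∈ c, a ∉ G) ∧ ∃ H ∈ c, b ∉ H := by simpa using h
    rcases hchain.total hG hH with hGH | hHG
    · exact ((hc G hG).sup_mem_iff.1 (hab G hG)).elim haG fun hb => hbH (hGH hb)
    · exact ((hc H hH).sup_mem_iff.1 (hab H hH)).elim (fun ha => haG (hHG ha)) hbH

end IsPrimeFilter

namespace PriestleyDual

variable {L : Type*} [Order.Frame L]

/-- The Stone map, sending `a` to the set of prime filters containing `a`. -/
def stoneMap (a : L) : Set (PriestleyDual L) := {x | a ∈ x.val}

theorem exists_mem_disjoint_ideal {a : L} {I : Order.Ideal L} (ha : a ∉ I) :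
    ∃ x : PriestleyDual L, a ∈ x.val ∧ ∀ b ∈ I, b ∉ x.val := by
  obtain ⟨J, hJ, hIJ, hdisj⟩ := DistribLattice.prime_ideal_of_disjoint_filter_ideal
    (F := Order.PFilter.principal a) (I := I)
    (disjoint_left.2 fun b hab hb => ha (I.lower hab hb))
  have haJ : a ∉ J := disjoint_left.1 hdisj (le_refl a)
  refine ⟨⟨(J : Set L)ᶜ, ⟨a, haJ⟩, fun h => ?_, fun b hb c hbc hc => hb (J.lower hbc hc),
    fun b hb c hc h => (hJ.mem_or_mem h).elim hb hc, fun b c h => ?_⟩, haJ,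
    fun b hb h => h (hIJ hb)⟩
  · exact (h ▸ mem_univ (⊥ : L) : ⊥ ∈ (J : Set L)ᶜ) J.bot_mem
  · by_contra! hbc
    exact h (J.sup_mem (not_not.1 hbc.1) (not_not.1 hbc.2))

theorem stoneMap_subset_iff {a b : L} : stoneMap a ⊆ stoneMap b ↔ a ≤ b := by
  refine ⟨fun h => ?_, fun hab x hx => x.2.mem_of_le hx hab⟩
  by_contra hab
  obtain ⟨x, hax, hx⟩ :=
    exists_mem_disjoint_ideal (I := Order.Ideal.principal b) (a := a) hab
  exact hx b le_rfl (h hax)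

theorem isClopen_stoneMap (a : L) : IsClopen (stoneMap a) :=
  ⟨isOpen_compl_iff.1 (.basic _ (.inr ⟨a, rfl⟩)), .basic _ (.inl ⟨a, rfl⟩)⟩

theorem isUpperSet_stoneMap (a : L) : IsUpperSet (stoneMap a) := fun _ _ hxy hx => hxy hx

theorem stoneMap_mem_clopUp (a : L) : stoneMap a ∈ ClopUp (PriestleyDual L) :=
  ⟨isClopen_stoneMap a, isUpperSet_stoneMap a⟩

theorem exists_stoneMap_inter_compl_subset {W : Set (PriestleyDual L)} (hW : IsOpen W)
    {x : PriestleyDual L} (hx : x ∈ W) :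
    ∃ b ∈ x.val, ∃ c ∉ x.val, stoneMap b ∩ (stoneMap c)ᶜ ⊆ W := by
  induction hW with
  | basic s hs =>
    rcases hs with ⟨a, rfl⟩ | ⟨a, rfl⟩
    · exact ⟨a, hx, ⊥, x.2.bot_notMem, inter_subset_left⟩
    · exact ⟨⊤, x.2.top_mem, a, hx, inter_subset_right⟩
  | univ => exact ⟨⊤, x.2.top_mem, ⊥, x.2.bot_notMem, subset_univ _⟩
  | inter s t _ _ hs ht =>
    obtain ⟨b, hb, c, hc, h⟩ := hs hx.1
    obtain ⟨b', hb', c', hc', h'⟩ := ht hx.2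
    refine ⟨b ⊓ b', x.2.inf_mem_iff.2 ⟨hb, hb'⟩, c ⊔ c',
      fun h => (x.2.sup_mem_iff.1 h).elim hc hc', fun y hy => ?_⟩
    have hy₁ := y.2.inf_mem_iff.1 hy.1
    have hy₂ := not_or.1 (mt y.2.sup_mem_iff.2 hy.2)
    exact ⟨h ⟨hy₁.1, hy₂.1⟩, h' ⟨hy₁.2, hy₂.2⟩⟩
  | sUnion S _ ih =>
    obtain ⟨s, hs, hxs⟩ := hx
    obtain ⟨b, hb, c, hc, h⟩ := ih s hs hxs
    exact ⟨b, hb, c, hc, h.trans (subset_sUnion_of_mem hs)⟩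

instance : CompactSpace (PriestleyDual L) where
  isCompact_univ := by
    rw [isCompact_iff_ultrafilter_le_nhds]
    intro f _
    have hprime : IsPrimeFilter {a : L | stoneMap a ∈ f} := by
      refine ⟨⟨⊤, Filter.mem_of_superset Filter.univ_mem fun x _ => x.2.top_mem⟩, fun h => ?_,
        fun a ha b hab => Filter.mem_of_superset ha (stoneMap_subset_iff.2 hab),
        fun a ha b hb => Filter.mem_of_superset (Filter.inter_mem ha hb)
          fun x hx => x.2.inf_mem_iff.2 hx,
        fun a b hab => Ultrafilter.union_mem_iff.1
          (Filter.mem_of_superset hab fun x hx => x.2.sup_mem_iff.1 hx)⟩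
      have hbot : stoneMap (⊥ : L) ∈ f := (h ▸ mem_univ (⊥ : L) : ⊥ ∈ {a : L | stoneMap a ∈ f})
      exact f.empty_notMem (Filter.mem_of_superset hbot fun x hx => x.2.bot_notMem hx)
    refine ⟨⟨_, hprime⟩, mem_univ _, ?_⟩
    intro W hW
    obtain ⟨V, hVW, hV, hxV⟩ := mem_nhds_iff.1 hW
    obtain ⟨b, hb, c, hc, h⟩ := exists_stoneMap_inter_compl_subset hV hxV
    exact Filter.mem_of_superset (Filter.inter_mem hb (Ultrafilter.compl_mem_iff_notMem.2 hc))
      (h.trans hVW)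

theorem exists_eq_stoneMap {U : Set (PriestleyDual L)} (hU : U ∈ ClopUp (PriestleyDual L)) :
    ∃ a : L, U = stoneMap a := by
  have hpoint : ∀ x ∈ U, ∃ a ∈ x.val, stoneMap a ⊆ U := by
    intro x hx
    suffices h : ∃ a ∈ x.val, Uᶜ ⊆ (stoneMap a)ᶜ from
      let ⟨a, hax, ha⟩ := h
      ⟨a, hax, compl_subset_compl.1 ha⟩
    refine hU.1.compl.1.isCompact.induction_on (p := fun s => ∃ a ∈ x.val, s ⊆ (stoneMap a)ᶜ)
      ⟨⊤, x.2.top_mem, empty_subset _⟩ (fun s t hst ⟨a, hax, ha⟩ => ⟨a, hax, hst.trans ha⟩)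
      (fun s t ⟨a, hax, ha⟩ ⟨b, hbx, hb⟩ =>
        ⟨a ⊓ b, x.2.inf_mem_iff.2 ⟨hax, hbx⟩, union_subset
          (ha.trans (compl_subset_compl.2 (stoneMap_subset_iff.2 inf_le_left)))
          (hb.trans (compl_subset_compl.2 (stoneMap_subset_iff.2 inf_le_right)))⟩)
      fun y hy => ?_
    obtain ⟨a, hax, hay⟩ := not_subset.1 fun hxy : x.val ⊆ y.val => hy (hU.2 hxy hx)
    exact ⟨_, mem_nhdsWithin_of_mem_nhds ((isClopen_stoneMap a).compl.2.mem_nhds hay),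
      a, hax, subset_rfl⟩
  suffices h : ∃ a : L, U ⊆ stoneMap a ∧ stoneMap a ⊆ U from
    let ⟨a, h₁, h₂⟩ := h
    ⟨a, h₁.antisymm h₂⟩
  refine hU.1.1.isCompact.induction_on (p := fun s => ∃ a : L, s ⊆ stoneMap a ∧ stoneMap a ⊆ U)
    ⟨⊥, empty_subset _, fun x hx => (x.2.bot_notMem hx).elim⟩
    (fun s t hst ⟨a, ha, haU⟩ => ⟨a, hst.trans ha, haU⟩)
    (fun s t ⟨a, ha, haU⟩ ⟨b, hb, hbU⟩ => ⟨a ⊔ b, union_subset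
      (ha.trans (stoneMap_subset_iff.2 le_sup_left))
      (hb.trans (stoneMap_subset_iff.2 le_sup_right)),
      fun x hx => (x.2.sup_mem_iff.1 hx).elim (haU ·) (hbU ·)⟩)
    fun x hx => ?_
  obtain ⟨a, hax, haU⟩ := hpoint x hx
  exact ⟨_, mem_nhdsWithin_of_mem_nhds ((isClopen_stoneMap a).2.mem_nhds hax),
    a, subset_rfl, haU⟩

theorem closure_biUnion_stoneMap (S : Set L) :
    closure (⋃ s ∈ S, stoneMap s) = stoneMap (sSup S) := by
  refine (closure_minimal (iUnion₂_subset fun s hs => stoneMap_subset_iff.2 (le_sSup hs))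
    (isClopen_stoneMap _).1).antisymm fun x hx => mem_closure_iff.2 fun W hW hxW => ?_
  obtain ⟨b, hb, c, hc, hbc⟩ := exists_stoneMap_inter_compl_subset hW hxW
  by_contra hdisj
  have hle : sSup S ⊓ b ≤ c := by
    rw [sSup_inf_eq]
    refine iSup₂_le fun s hs => stoneMap_subset_iff.1 fun y hy => ?_
    obtain ⟨hys, hyb⟩ := y.2.inf_mem_iff.1 hy
    by_contra hyc
    exact hdisj ⟨y, hbc ⟨hyb, hyc⟩, mem_biUnion hs hys⟩
  exact hc (x.2.mem_of_le (x.2.inf_mem_iff.2 ⟨hx, hb⟩) hle)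

theorem exists_minimal_le {a : L} {x : PriestleyDual L} (hx : x ∈ stoneMap a) :
    ∃ y ∈ stoneMap a, y ≤ x ∧ ∀ z ∈ stoneMap a, z ≤ y → z = y := by
  obtain ⟨G, hGx, ⟨hG, haG⟩, hmin⟩ := zorn_superset_nonempty {G : Set L | IsPrimeFilter G ∧ a ∈ G}
    (fun c hc hchain hne => ⟨⋂₀ c,
      ⟨IsPrimeFilter.sInter_of_isChain (fun G hG => (hc hG).1) hchain hne, fun G hG => (hc hG).2⟩,
      fun _ => sInter_subset_of_mem⟩) x.val ⟨x.2, hx⟩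
  exact ⟨⟨G, hG⟩, haG, hGx, fun z hz hzy => le_antisymm hzy (hmin ⟨z.2, hz⟩ hzy)⟩

theorem mem_spatialPart_of_minimal {a : L} (ha : IsCompactElt a) {y : PriestleyDual L}
    (hy : y ∈ stoneMap a) (hmin : ∀ z ∈ stoneMap a, z ≤ y → z = y) :
    y ∈ spatialPart (PriestleyDual L) := by
  have hsup : ∀ c ∈ y.val, ∃ d ∉ y.val, a ≤ d ⊔ c := by
    intro c hc
    by_contra! h
    obtain ⟨x, hax, hx⟩ := exists_mem_disjoint_ideal
      (I := y.2.complIdeal ⊔ Order.Ideal.principal c) (a := a) (by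
        rw [Lattice.mem_ideal_sup_principal]
        rintro ⟨d, hd, had⟩
        exact h d hd had)
    have hxy : x ≤ y := fun d hdx => by
      by_contra hdy
      exact hx d ((le_sup_left : y.2.complIdeal ≤ _) hdy) hdx
    obtain rfl := hmin x hax hxy
    exact hx c ((le_sup_right : Order.Ideal.principal c ≤ _) le_rfl) hc
  have hnot : sSup y.valᶜ ∉ y.val := by
    intro h
    obtain ⟨d, hd, had⟩ := hsup _ h
    obtain ⟨T, hT, hfin, haT⟩ := ha y.valᶜ (had.trans (sup_le (le_sSup hd) le_rfl))
    obtain ⟨t, ht, hty⟩ := (y.2.sSup_mem_iff_of_finite hfin).1 (y.2.mem_of_le hy haT)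
    exact hT ht hty
  have heq : {x | x ≤ y} = (stoneMap (sSup y.valᶜ))ᶜ := by
    ext x
    refine ⟨fun hxy hx => hnot (hxy hx), fun hx c hc => ?_⟩
    by_contra hcy
    exact hx (x.2.mem_of_le hc (le_sSup hcy))
  change IsClopen {x | x ≤ y}
  rw [heq]
  exact (isClopen_stoneMap _).compl

theorem stoneMap_mem_clopSUp_iff {a : L} :
    stoneMap a ∈ ClopSUp (PriestleyDual L) ↔ IsCompactElt a := by
  refine ⟨fun h S haS => ?_, fun ha => ⟨isClopen_stoneMap a, (isClopen_stoneMap a).1,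
    isUpperSet_stoneMap a, fun y => mem_spatialPart_of_minimal ha⟩⟩
  have hcover : stoneMap a ⊆ ⋃ s ∈ S, stoneMap s := by
    intro x hx
    obtain ⟨y, hy, hyx, hmin⟩ := exists_minimal_le hx
    have hycl : y ∈ closure (⋃ s ∈ S, stoneMap s) :=
      closure_biUnion_stoneMap S ▸ stoneMap_subset_iff.2 haS hy
    obtain ⟨z, hzy, hz⟩ := mem_closure_iff.1 hycl _ (h.2.2.2 y hy hmin).2 (le_refl y)
    obtain ⟨s, hs, hzs⟩ := mem_iUnion₂.1 hz
    exact mem_biUnion hs (hyx (hzy hzs))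
  obtain ⟨T, hTS, hT, haT⟩ := (isClopen_stoneMap a).1.isCompact.elim_finite_subcover_image
    (fun s _ => (isClopen_stoneMap s).2) hcover
  exact ⟨T, hTS, hT, stoneMap_subset_iff.1 (haT.trans
    (iUnion₂_subset fun t ht => stoneMap_subset_iff.2 (le_sSup ht)))⟩

theorem coreSet_stoneMap (a : L) :
    coreSet (PriestleyDual L) (stoneMap a) =
      ⋃ k ∈ {k : L | IsCompactElt k ∧ k ≤ a}, stoneMap k := by
  refine Subset.antisymm (sUnion_subset ?_) (iUnion₂_subset fun k hk =>
    subset_sUnion_of_mem ⟨stoneMap_mem_clopSUp_iff.2 hk.1, stoneMap_subset_iff.2 hk.2⟩)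
  rintro V ⟨hV, hVa⟩
  obtain ⟨k, rfl⟩ := exists_eq_stoneMap ⟨hV.1, hV.2.2.1⟩
  exact subset_biUnion_of_mem (u := stoneMap)
    (show k ∈ {k : L | _} from ⟨stoneMap_mem_clopSUp_iff.1 hV, stoneMap_subset_iff.1 hVa⟩)

theorem subset_closure_coreSet_iff (a : L) :
    stoneMap a ⊆ closure (coreSet (PriestleyDual L) (stoneMap a)) ↔
      a = sSup {k : L | IsCompactElt k ∧ k ≤ a} := by
  rw [coreSet_stoneMap, closure_biUnion_stoneMap, stoneMap_subset_iff]
  exact ⟨fun h => h.antisymm (sSup_le fun k hk => hk.2), fun h => h.le⟩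

end PriestleyDual

/-- a frame is algebraic iff in its Priestley space the core of every
clopen upset is dense in it. -/
theorem stmt8 (L : Type*) [Order.Frame L] :
    AlgebraicFrame L ↔
      ∀ U ∈ ClopUp (PriestleyDual L), U ⊆ closure (coreSet (PriestleyDual L) U) := by
  refine ⟨fun h U hU => ?_, fun h a => (PriestleyDual.subset_closure_coreSet_iff a).1
    (h _ (PriestleyDual.stoneMap_mem_clopUp a))⟩
  obtain ⟨a, rfl⟩ := PriestleyDual.exists_eq_stoneMap hU
  exact (PriestleyDual.subset_closure_coreSet_iff a).2 (h a)
end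

section
/- Let Y be a compactly based sober topological space. Then Y is stably locally compact if and only if Y is stably compactly based. In particular, under these hypotheses the intersection of any two compact saturated subsets of Y is compact if and only if the intersection of any two compact open subsets of Y is compact. -/
open Set Topology

theorem IsOpen.isSaturatedSet {Y : Type*} [TopologicalSpace Y] {U : Set Y} (hU : IsOpen U) :
    IsSaturatedSet U :=
  (subset_sInter fun _ h => h.2).antisymm (sInter_subset_of_mem ⟨hU, Subset.rfl⟩)

theorem IsSaturatedSet.mem_of_specializes {Y : Type*} [TopologicalSpace Y] {K : Set Y}
    (hK : IsSaturatedSet K) {x y : Y} (h : x ⤳ y) (hy : y ∈ K) : x ∈ K := by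
  rw [hK]
  exact fun U hU => h.mem_open hU.1 (hU.2 hy)

theorem CompactlyBased.locallyCompactSpace {Y : Type*} [TopologicalSpace Y]
    (hcb : CompactlyBased Y) : LocallyCompactSpace Y := by
  refine ⟨fun y V hV => ?_⟩
  obtain ⟨W, hWV, hW, hyW⟩ := mem_nhds_iff.1 hV
  obtain ⟨K, hKo, hKc, hyK, hKW⟩ := hcb W hW y hyW
  exact ⟨K, hKo.mem_nhds hyK, hKW.trans hWV, hKc⟩

/-- If compact open sets form a basis closed under binary intersections, then the set of limits
of a convergent ultrafilter is irreducible. -/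
theorem CompactlyBased.isIrreducible_setOf_clusterPt {Y : Type*} [TopologicalSpace Y]
    (hcb : CompactlyBased Y)
    (hinter : ∀ U₁ U₂ : Set Y, IsCompact U₁ → IsOpen U₁ → IsCompact U₂ → IsOpen U₂ →
      IsCompact (U₁ ∩ U₂))
    (F : Ultrafilter Y) (hF : ∃ x, ClusterPt x (F : Filter Y)) :
    IsIrreducible {x | ClusterPt x (F : Filter Y)} := by
  refine ⟨hF, fun U V hU hV => ?_⟩
  rintro ⟨x, hx, hxU⟩ ⟨y, hy, hyV⟩
  obtain ⟨A, hAo, hAc, hxA, hAU⟩ := hcb U hU x hxU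
  obtain ⟨B, hBo, hBc, hyB, hBV⟩ := hcb V hV y hyV
  have hA : A ∈ F := Ultrafilter.clusterPt_iff.1 hx (hAo.mem_nhds hxA)
  have hB : B ∈ F := Ultrafilter.clusterPt_iff.1 hy (hBo.mem_nhds hyB)
  obtain ⟨z, hz, hzF⟩ :=
    hinter A B hAc hAo hBc hBo (Filter.le_principal_iff.2 (Filter.inter_mem hA hB))
  exact ⟨z, hzF, hAU hz.1, hBV hz.2⟩

theorem CompactlyBased.isCompact_inter {Y : Type*} [TopologicalSpace Y] [QuasiSober Y]
    (hcb : CompactlyBased Y)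
    (hinter : ∀ U₁ U₂ : Set Y, IsCompact U₁ → IsOpen U₁ → IsCompact U₂ → IsOpen U₂ →
      IsCompact (U₁ ∩ U₂))
    {K₁ K₂ : Set Y} (h₁ : IsCompact K₁) (hs₁ : IsSaturatedSet K₁)
    (h₂ : IsCompact K₂) (hs₂ : IsSaturatedSet K₂) : IsCompact (K₁ ∩ K₂) := by
  refine isCompact_iff_ultrafilter_le_nhds.2 fun F hF => ?_
  obtain ⟨x₁, hx₁, hF₁⟩ := isCompact_iff_ultrafilter_le_nhds.1 h₁ F
    (hF.trans (Filter.principal_mono.2 inter_subset_left))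
  obtain ⟨x₂, hx₂, hF₂⟩ := isCompact_iff_ultrafilter_le_nhds.1 h₂ F
    (hF.trans (Filter.principal_mono.2 inter_subset_right))
  obtain ⟨g, hg⟩ := QuasiSober.sober
    (hcb.isIrreducible_setOf_clusterPt hinter F ⟨x₁, Ultrafilter.clusterPt_iff.2 hF₁⟩)
    isClosed_setOfPred_clusterPt
  exact ⟨g, ⟨hs₁.mem_of_specializes (hg.specializes (Ultrafilter.clusterPt_iff.2 hF₁)) hx₁,
    hs₂.mem_of_specializes (hg.specializes (Ultrafilter.clusterPt_iff.2 hF₂)) hx₂⟩,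
    Ultrafilter.clusterPt_iff.1 hg.mem⟩

/-- for a compactly based sober space, stably locally compact iff
stably compactly based; in particular, coherence for compact saturated sets is
equivalent to coherence for compact open sets. -/
theorem stmt10 (Y : Type*) [TopologicalSpace Y]
    (hcb : CompactlyBased Y) (hT0 : T0Space Y) (hsob : QuasiSober Y) :
    ((LocallyCompactSpace Y ∧
        ∀ K₁ K₂ : Set Y, IsCompact K₁ → IsSaturatedSet K₁ →
          IsCompact K₂ → IsSaturatedSet K₂ → IsCompact (K₁ ∩ K₂)) ↔
      ∀ U₁ U₂ : Set Y, IsCompact U₁ → IsOpen U₁ → IsCompact U₂ → IsOpen U₂ →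
        IsCompact (U₁ ∩ U₂)) ∧
    ((∀ K₁ K₂ : Set Y, IsCompact K₁ → IsSaturatedSet K₁ →
        IsCompact K₂ → IsSaturatedSet K₂ → IsCompact (K₁ ∩ K₂)) ↔
      ∀ U₁ U₂ : Set Y, IsCompact U₁ → IsOpen U₁ → IsCompact U₂ → IsOpen U₂ →
        IsCompact (U₁ ∩ U₂)) := by
  have key : (∀ K₁ K₂ : Set Y, IsCompact K₁ → IsSaturatedSet K₁ →
        IsCompact K₂ → IsSaturatedSet K₂ → IsCompact (K₁ ∩ K₂)) ↔
      ∀ U₁ U₂ : Set Y, IsCompact U₁ → IsOpen U₁ → IsCompact U₂ → IsOpen U₂ →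
        IsCompact (U₁ ∩ U₂) :=
    ⟨fun h U₁ U₂ hc₁ ho₁ hc₂ ho₂ => h U₁ U₂ hc₁ ho₁.isSaturatedSet hc₂ ho₂.isSaturatedSet,
      fun h _ _ hc₁ hs₁ hc₂ hs₂ => hcb.isCompact_inter h hc₁ hs₁ hc₂ hs₂⟩
  exact ⟨(and_iff_right hcb.locallyCompactSpace).trans key, key⟩
end

section
/- Let L be an algebraic frame, X_L its Priestley space, and Y_L the spatial part of X_L equipped with the topology generated by {U ∩ Y_L : U a clopen upset of X_L}. The following are equivalent: (1) L is an arithmetic frame; (2) X_L is kernel-stable, i.e., ker(U ∩ V) = ker U ∩ ker V for all clopen upsets U, V of X_L; (3) Y_L is a stably compactly based space. -/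
open Set Topology

namespace PriestleyDual

variable {L : Type*} [Order.Frame L]

/-- The basic clopen upset of prime filters containing `a`. -/
def basicUp (a : L) : Set (PriestleyDual L) := {x | a ∈ x.val}

theorem top_mem (x : PriestleyDual L) : ⊤ ∈ x.val := by
  obtain ⟨a, ha⟩ := x.2.1
  exact x.2.2.2.1 a ha _ le_top

theorem mem_of_le (x : PriestleyDual L) {a b : L} (ha : a ∈ x.val) (hab : a ≤ b) : b ∈ x.val :=
  x.2.2.2.1 a ha b hab

theorem bot_notMem (x : PriestleyDual L) : ⊥ ∉ x.val := fun h =>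
  x.2.2.1 (eq_univ_of_forall fun _ => mem_of_le x h bot_le)

theorem inf_mem_iff (x : PriestleyDual L) {a b : L} :
    a ⊓ b ∈ x.val ↔ a ∈ x.val ∧ b ∈ x.val :=
  ⟨fun h => ⟨mem_of_le x h inf_le_left, mem_of_le x h inf_le_right⟩,
    fun h => x.2.2.2.2.1 a h.1 b h.2⟩

theorem sup_mem_iff (x : PriestleyDual L) {a b : L} :
    a ⊔ b ∈ x.val ↔ a ∈ x.val ∨ b ∈ x.val :=
  ⟨x.2.2.2.2.2 a b, fun h => h.elim (fun h => mem_of_le x h le_sup_left)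
    fun h => mem_of_le x h le_sup_right⟩

theorem exists_mem_of_sSup_mem (x : PriestleyDual L) {T : Set L} (hT : T.Finite)
    (h : sSup T ∈ x.val) : ∃ t ∈ T, t ∈ x.val := by
  induction T, hT using Set.Finite.induction_on with
  | empty => exact absurd (by simpa using h) (bot_notMem x)
  | insert _ _ ih =>
    rw [sSup_insert, sup_mem_iff] at h
    rcases h with h | h
    · exact ⟨_, mem_insert _ _, h⟩
    · obtain ⟨t, ht, htx⟩ := ih h
      exact ⟨t, mem_insert_of_mem _ ht, htx⟩

theorem basicUp_inf (a b : L) : basicUp (a ⊓ b) = basicUp a ∩ basicUp b :=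
  ext fun x => inf_mem_iff x

theorem basicUp_mono {a b : L} (h : a ≤ b) : basicUp a ⊆ basicUp b :=
  fun x hx => mem_of_le x hx h

theorem isClopen_basicUp (a : L) : IsClopen (basicUp a) :=
  ⟨⟨TopologicalSpace.isOpen_generateFrom_of_mem (Or.inr ⟨a, rfl⟩)⟩,
    TopologicalSpace.isOpen_generateFrom_of_mem (Or.inl ⟨a, rfl⟩)⟩

theorem isUpperSet_basicUp (a : L) : IsUpperSet (basicUp a) := fun _ _ hxy hx => hxy hx

theorem basicUp_mem_clopUp (a : L) : basicUp a ∈ ClopUp (PriestleyDual L) :=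
  ⟨isClopen_basicUp a, isUpperSet_basicUp a⟩

theorem basicUp_subset_iff {a b : L} : basicUp a ⊆ basicUp b ↔ a ≤ b := by
  refine ⟨fun h => ?_, basicUp_mono⟩
  by_contra hab
  obtain ⟨J, hJ, hbJ, hd⟩ := DistribLattice.prime_ideal_of_disjoint_filter_ideal
    (F := Order.PFilter.principal a) (I := Order.Ideal.principal b) (by
      rw [Set.disjoint_left]
      intro c hac hcb
      exact hab (le_trans (by simpa using hac) (by simpa using hcb)))
  have haJ : a ∉ J := fun h => Set.disjoint_left.1 hd (by simp) h
  have hb : b ∈ J := hbJ (by simp)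
  let x : PriestleyDual L := ⟨{c | c ∉ J}, ⟨a, haJ⟩, fun h => (h ▸ mem_univ b : b ∈ {c | c ∉ J}) hb,
    fun c hc d hcd hd => hc (J.lower hcd hd),
    fun c hc d hd hcd => (hJ.mem_or_mem hcd).elim hc hd,
    fun c d hcd => by
      by_contra! h
      simp only [mem_ofPred_eq, not_not] at h
      exact hcd (Order.Ideal.sup_mem h.1 h.2)⟩
  exact (h (show x ∈ basicUp a from haJ)) hb

instance inst_s11 : CompactSpace (PriestleyDual L) := by
  refine ⟨isCompact_iff_ultrafilter_le_nhds.2 fun f _ => ?_⟩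
  have hmono : ∀ {a b : L}, basicUp a ∈ f → a ≤ b → basicUp b ∈ f :=
    fun ha hab => Filter.mem_of_superset ha (basicUp_mono hab)
  let x : PriestleyDual L := ⟨{a | basicUp a ∈ f},
    ⟨⊤, Filter.mem_of_superset Filter.univ_mem fun x _ => top_mem x⟩,
    fun h => by
      have hb : basicUp (⊥ : L) ∈ f := (h ▸ mem_univ _ : (⊥ : L) ∈ {a | basicUp a ∈ f})
      obtain ⟨x, hx⟩ := f.nonempty_of_mem hb
      exact bot_notMem x hx,
    fun a ha b hab => hmono ha hab,
    fun a ha b hb => by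
      rw [mem_ofPred_eq, basicUp_inf]
      exact Filter.inter_mem ha hb,
    fun a b hab => by
      refine Ultrafilter.union_mem_iff.1 (Filter.mem_of_superset hab fun x hx => ?_)
      exact (sup_mem_iff x).1 hx⟩
  refine ⟨x, mem_univ _, ?_⟩
  rw [TopologicalSpace.nhds_generateFrom]
  refine le_iInf₂ fun s hs => Filter.le_principal_iff.2 ?_
  obtain ⟨hxs, ⟨a, rfl⟩ | ⟨a, rfl⟩⟩ := hs
  · exact hxs
  · exact Ultrafilter.compl_mem_iff_notMem.2 hxs

theorem exists_finite_of_basicUp_subset {a : L} {S : Set L}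
    (h : basicUp a ⊆ ⋃ s ∈ S, basicUp s) : ∃ T ⊆ S, T.Finite ∧ a ≤ sSup T := by
  obtain ⟨T, hTS, hT, haT⟩ := (isClopen_basicUp a).1.isCompact.elim_finite_subcover_image
    (fun s _ => (isClopen_basicUp s).2) h
  refine ⟨T, hTS, hT, basicUp_subset_iff.1 fun x hx => ?_⟩
  obtain ⟨t, ht, hxt⟩ := mem_iUnion₂.1 (haT hx)
  exact mem_of_le x hxt (le_sSup ht)

theorem exists_basicUp_subset {x : PriestleyDual L} {W : Set (PriestleyDual L)} (hW : IsOpen W)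
    (hup : IsUpperSet W) (hx : x ∈ W) : ∃ a ∈ x.val, basicUp a ⊆ W := by
  have hcov : Wᶜ ⊆ ⋃ a ∈ x.val, (basicUp a)ᶜ := fun z hz => by
    have : ¬ x.val ⊆ z.val := fun h => hz (hup h hx)
    obtain ⟨a, hax, haz⟩ := not_subset.1 this
    exact mem_iUnion₂.2 ⟨a, hax, haz⟩
  obtain ⟨T, hTx, hT, hcovT⟩ := hW.isClosed_compl.isCompact.elim_finite_subcover_image
    (fun a _ => (isClopen_basicUp a).compl.2) hcov
  refine ⟨sInf T, ?_, fun z hz => ?_⟩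
  · clear hcovT
    induction T, hT using Set.Finite.induction_on with
    | empty => simpa using top_mem x
    | insert _ _ ih =>
      rw [sInf_insert, inf_mem_iff]
      exact ⟨hTx (mem_insert _ _), ih ((subset_insert _ _).trans hTx)⟩
  · by_contra hzW
    obtain ⟨t, ht, hzt⟩ := mem_iUnion₂.1 (hcovT hzW)
    exact hzt (mem_of_le z hz (sInf_le ht))

theorem mem_clopUp_iff {U : Set (PriestleyDual L)} :
    U ∈ ClopUp (PriestleyDual L) ↔ ∃ a, U = basicUp a := by
  refine ⟨fun ⟨hU, hup⟩ => ?_, fun ⟨a, ha⟩ => ha ▸ basicUp_mem_clopUp a⟩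
  obtain ⟨T, hTS, hT, hcov⟩ := hU.1.isCompact.elim_finite_subcover_image
    (b := {a : L | basicUp a ⊆ U}) (fun a _ => (isClopen_basicUp a).2) fun x hx => by
      obtain ⟨a, hax, haU⟩ := exists_basicUp_subset hU.2 hup hx
      exact mem_iUnion₂.2 ⟨a, haU, hax⟩
  refine ⟨sSup T, Subset.antisymm (fun x hx => ?_) fun x hx => ?_⟩
  · obtain ⟨t, ht, hxt⟩ := mem_iUnion₂.1 (hcov hx)
    exact mem_of_le x hxt (le_sSup ht)
  · obtain ⟨t, ht, hxt⟩ := exists_mem_of_sSup_mem x hT hx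
    exact hTS ht hxt

theorem exists_basicUp_diff_subset {x : PriestleyDual L} {O : Set (PriestleyDual L)}
    (hO : IsOpen O) (hx : x ∈ O) :
    ∃ c ∈ x.val, ∃ d ∉ x.val, basicUp c \ basicUp d ⊆ O := by
  induction hO with
  | basic s hs =>
    obtain ⟨a, rfl⟩ | ⟨a, rfl⟩ := hs
    · exact ⟨a, hx, ⊥, bot_notMem x, fun z hz => hz.1⟩
    · exact ⟨⊤, top_mem x, a, hx, fun z hz => hz.2⟩
  | univ => exact ⟨⊤, top_mem x, ⊥, bot_notMem x, subset_univ _⟩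
  | inter s t _ _ ihs iht =>
    obtain ⟨c, hc, d, hd, h⟩ := ihs hx.1
    obtain ⟨c', hc', d', hd', h'⟩ := iht hx.2
    refine ⟨c ⊓ c', (inf_mem_iff x).2 ⟨hc, hc'⟩, d ⊔ d', ?_, fun z hz => ?_⟩
    · rw [sup_mem_iff]
      tauto
    · have h1 := (inf_mem_iff z).1 hz.1
      exact ⟨h ⟨h1.1, fun h2 => hz.2 ((sup_mem_iff z).2 (Or.inl h2))⟩,
        h' ⟨h1.2, fun h2 => hz.2 ((sup_mem_iff z).2 (Or.inr h2))⟩⟩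
  | sUnion S _ ih =>
    obtain ⟨s, hs, hxs⟩ := hx
    obtain ⟨c, hc, d, hd, h⟩ := ih s hs hxs
    exact ⟨c, hc, d, hd, h.trans (subset_sUnion_of_mem hs)⟩

theorem basicUp_sSup_subset_closure {S : Set L} {W : Set (PriestleyDual L)}
    (h : ∀ s ∈ S, basicUp s ⊆ W) : basicUp (sSup S) ⊆ closure W := by
  intro x hx
  refine mem_closure_iff.2 fun O hO hxO => ?_
  obtain ⟨c, hc, d, hd, hcd⟩ := exists_basicUp_diff_subset hO hxO
  by_contra hne
  refine hd (mem_of_le x ((inf_mem_iff x).2 ⟨hx, hc⟩) ?_)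
  rw [sSup_inf_eq]
  refine iSup₂_le fun s hs => basicUp_subset_iff.1 fun z hz => ?_
  by_contra hzd
  have hz := (inf_mem_iff z).1 hz
  exact hne ⟨z, hcd ⟨hz.2, hzd⟩, h s hs hz.1⟩

theorem wayBelowSet_basicUp_iff {a b : L} :
    wayBelowSet (PriestleyDual L) (basicUp a) (basicUp b) ↔ frameWayBelow a b := by
  refine ⟨fun h S hbS => ?_, fun h W hW hup hbW => ?_⟩
  · exact exists_finite_of_basicUp_subset <| h (⋃ s ∈ S, basicUp s)
      (isOpen_biUnion fun s _ => (isClopen_basicUp s).2)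
      (isUpperSet_iUnion₂ fun s _ => isUpperSet_basicUp s)
      ((basicUp_mono hbS).trans
        (basicUp_sSup_subset_closure fun s hs => subset_biUnion_of_mem hs))
  · have hWs : W ⊆ basicUp (sSup {c : L | basicUp c ⊆ W}) := fun x hx => by
      obtain ⟨c, hcx, hcW⟩ := exists_basicUp_subset hW hup hx
      exact mem_of_le x hcx (le_sSup hcW)
    obtain ⟨T, hTS, hT, haT⟩ := h {c : L | basicUp c ⊆ W} <| basicUp_subset_iff.1 <|
      hbW.trans (closure_minimal hWs (isClopen_basicUp _).1)
    intro x hx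
    obtain ⟨t, ht, hxt⟩ := exists_mem_of_sSup_mem x hT (mem_of_le x hx haT)
    exact hTS ht hxt

theorem mem_kerSet_basicUp_iff {b : L} {x : PriestleyDual L} :
    x ∈ kerSet (PriestleyDual L) (basicUp b) ↔ ∃ a ∈ x.val, frameWayBelow a b := by
  constructor
  · rintro ⟨V, ⟨hV, hVb⟩, hxV⟩
    obtain ⟨a, rfl⟩ := mem_clopUp_iff.1 hV
    exact ⟨a, hxV, wayBelowSet_basicUp_iff.1 hVb⟩
  · rintro ⟨a, hax, hab⟩
    exact ⟨basicUp a, ⟨basicUp_mem_clopUp a, wayBelowSet_basicUp_iff.2 hab⟩, hax⟩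

end PriestleyDual

section WayBelow

variable {L : Type*} [Order.Frame L]

theorem frameWayBelow.mono {a a' b b' : L} (h : frameWayBelow a b) (ha : a' ≤ a) (hb : b ≤ b') :
    frameWayBelow a' b' := fun S hS => by
  obtain ⟨T, hTS, hT, haT⟩ := h S (hb.trans hS)
  exact ⟨T, hTS, hT, ha.trans haT⟩

theorem frameWayBelow.sSup_of_finite {T : Set L} {b : L} (hT : T.Finite)
    (h : ∀ t ∈ T, frameWayBelow t b) : frameWayBelow (sSup T) b := by
  intro S hS
  choose! F hFS hF htF using fun t ht => h t ht S hS
  refine ⟨⋃ t ∈ T, F t, iUnion₂_subset hFS, hT.biUnion hF, sSup_le fun t ht => ?_⟩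
  exact (htF t ht).trans (sSup_le_sSup (subset_biUnion_of_mem ht))

theorem AlgebraicFrame.exists_isCompactElt_between (hL : AlgebraicFrame L) {a b : L}
    (h : frameWayBelow a b) : ∃ k, IsCompactElt k ∧ a ≤ k ∧ k ≤ b := by
  obtain ⟨T, hTS, hT, haT⟩ := h {k | IsCompactElt k ∧ k ≤ b} (hL b).le
  exact ⟨sSup T, frameWayBelow.sSup_of_finite hT fun t ht => (hTS ht).1.mono le_rfl (le_sSup ht),
    haT, sSup_le fun t ht => (hTS ht).2⟩

theorem AlgebraicFrame.arithmeticFrame_iff (hL : AlgebraicFrame L) :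
    ArithmeticFrame L ↔ ∀ k l : L, IsCompactElt k → IsCompactElt l → IsCompactElt (k ⊓ l) := by
  refine ⟨fun h k l hk hl => h.2 _ _ _ (hk.mono inf_le_left le_rfl) (hl.mono inf_le_right le_rfl),
    fun h => ⟨hL, fun a b c hab hac => ?_⟩⟩
  obtain ⟨k, hk, hak, hkb⟩ := hL.exists_isCompactElt_between hab
  obtain ⟨l, hl, hal, hlc⟩ := hL.exists_isCompactElt_between hac
  exact (h k l hk hl).mono (le_inf hak hal) (inf_le_inf hkb hlc)

theorem IsCompactElt.exists_maximal_not_le {k b : L} (hk : IsCompactElt k) (hkb : ¬ k ≤ b) :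
    ∃ p, b ≤ p ∧ Maximal (fun q => ¬ k ≤ q) p := by
  obtain ⟨p, hbp, hp⟩ := zorn_le_nonempty₀ {q : L | ¬ k ≤ q} (fun C hC hchain c hc => by
    refine ⟨sSup C, fun hle => ?_, fun z hz => le_sSup hz⟩
    obtain ⟨T, hTC, hT, hkT⟩ := hk C hle
    rcases T.eq_empty_or_nonempty with rfl | hne
    · exact hC hc (hkT.trans (by simp))
    · obtain ⟨m, hm, hmT⟩ := hT.exists_maximal hne
      refine hC (hTC hm) (hkT.trans (sSup_le fun t ht => ?_))
      exact (hchain.total (hTC ht) (hTC hm)).elim id (hmT ht)) b hkb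
  exact ⟨p, hbp, hp⟩

theorem Maximal.le_or_le_of_inf_le {k p c d : L} (hp : Maximal (fun q => ¬ k ≤ q) p)
    (h : c ⊓ d ≤ p) : c ≤ p ∨ d ≤ p := by
  by_contra! hcd
  have aux : ∀ e : L, ¬ e ≤ p → k ≤ p ⊔ e := fun e he => by
    by_contra hk
    exact he (le_sup_right.trans (hp.2 hk le_sup_left))
  refine hp.1 ((le_inf (aux c hcd.1) (aux d hcd.2)).trans ?_)
  rw [← sup_inf_left]
  exact sup_le le_rfl h

end WayBelow

namespace PriestleyDual

variable {L : Type*} [Order.Frame L]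

theorem mem_spatialPart_iff {y : PriestleyDual L} :
    y ∈ spatialPart (PriestleyDual L) ↔ ∀ S : Set L, sSup S ∈ y.val → ∃ s ∈ S, s ∈ y.val := by
  constructor
  · intro hy S hS
    obtain ⟨p, hp⟩ := mem_clopUp_iff.1
      (show {x | x ≤ y}ᶜ ∈ ClopUp (PriestleyDual L) from
        ⟨IsClopen.compl hy, fun a b hab ha hb => ha (le_trans hab hb)⟩)
    have hpy : p ∉ y.val := fun h => by
      have hy' : y ∈ {x | x ≤ y}ᶜ := hp.symm ▸ h
      exact hy' (le_refl y)
    by_contra! hne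
    refine hpy (mem_of_le y hS (sSup_le fun s hs => basicUp_subset_iff.1 fun x hx => ?_))
    rw [← hp]
    exact fun hxy => hne s hs (hxy hx)
  · intro h
    have hp : sSup {a | a ∉ y.val} ∉ y.val := fun hmem => by
      obtain ⟨s, hs, hsy⟩ := h _ hmem
      exact hs hsy
    have : {x | x ≤ y} = (basicUp (sSup {a | a ∉ y.val}))ᶜ := by
      ext x
      refine ⟨fun hxy hx => hp (hxy hx), fun hx a ha => ?_⟩
      by_contra hay
      exact hx (mem_of_le x ha (le_sSup hay))
    change IsClopen {x | x ≤ y}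
    rw [this]
    exact (isClopen_basicUp _).compl

/-- The trace of `basicUp a` on the spatial part. -/
def spatialUp (a : L) : Set (spatialPart (PriestleyDual L)) := (↑) ⁻¹' basicUp a

theorem spatialUp_inf (a b : L) : spatialUp (a ⊓ b) = spatialUp a ∩ spatialUp b :=
  ext fun x => inf_mem_iff x.1

theorem mem_spatialUp_sSup {S : Set L} {y : spatialPart (PriestleyDual L)} :
    y ∈ spatialUp (sSup S) ↔ ∃ s ∈ S, y ∈ spatialUp s :=
  ⟨mem_spatialPart_iff.1 y.2 S, fun ⟨_, hs, hy⟩ => mem_of_le y.1 hy (le_sSup hs)⟩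

theorem isOpen_spatialTop_iff {V : Set (spatialPart (PriestleyDual L))} :
    IsOpen[spatialTop (PriestleyDual L)] V ↔ ∃ a, V = spatialUp a := by
  constructor
  · intro hV
    induction hV with
    | basic s hs =>
      obtain ⟨U, hU, rfl⟩ := hs
      obtain ⟨a, rfl⟩ := mem_clopUp_iff.1 hU
      exact ⟨a, rfl⟩
    | univ => exact ⟨⊤, ext fun y => ⟨fun _ => top_mem y.1, fun _ => mem_univ y⟩⟩
    | inter s t _ _ ihs iht =>
      obtain ⟨a, rfl⟩ := ihs
      obtain ⟨b, rfl⟩ := iht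
      exact ⟨a ⊓ b, (spatialUp_inf a b).symm⟩
    | sUnion S _ ih =>
      refine ⟨sSup {a | spatialUp a ∈ S}, ext fun y => ?_⟩
      rw [mem_spatialUp_sSup]
      constructor
      · rintro ⟨s, hs, hy⟩
        obtain ⟨a, rfl⟩ := ih s hs
        exact ⟨a, hs, hy⟩
      · rintro ⟨a, ha, hy⟩
        exact ⟨_, ha, hy⟩
  · rintro ⟨a, rfl⟩
    exact TopologicalSpace.isOpen_generateFrom_of_mem ⟨basicUp a, basicUp_mem_clopUp a, rfl⟩

/-- The point of the spatial part given by a completely prime filter. -/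
def spatialPoint (F : Set L) (hF : IsCompletelyPrimeFilter F) : spatialPart (PriestleyDual L) :=
  ⟨⟨F, hF.1, hF.2.1, hF.2.2.1, hF.2.2.2.1, fun a b hab => by
    obtain ⟨s, rfl | rfl, hs⟩ := hF.2.2.2.2 {a, b} (by rwa [sSup_pair])
    exacts [Or.inl hs, Or.inr hs]⟩, mem_spatialPart_iff.2 hF.2.2.2.2⟩

theorem spatialUp_subset_iff (hL : AlgebraicFrame L) {a b : L} :
    spatialUp a ⊆ spatialUp b ↔ a ≤ b := by
  refine ⟨fun h => ?_, fun h => preimage_mono (basicUp_mono h)⟩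
  rw [hL a]
  refine sSup_le fun k ⟨hk, hka⟩ => ?_
  by_contra hkb
  obtain ⟨p, hbp, hp⟩ := hk.exists_maximal_not_le hkb
  let y := spatialPoint {c : L | ¬ c ≤ p} ⟨⟨k, hp.1⟩,
    fun h => (h ▸ mem_univ p : p ∈ {c | ¬ c ≤ p}) le_rfl,
    fun c hc d hcd hd => hc (hcd.trans hd),
    fun c hc d hd hcd => (hp.le_or_le_of_inf_le hcd).elim hc hd,
    fun S hS => by simpa [sSup_le_iff] using hS⟩
  exact h (show y ∈ spatialUp a from fun hap => hp.1 (hka.trans hap)) hbp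

theorem isCompact_spatialUp_iff (hL : AlgebraicFrame L) {a : L} :
    @IsCompact _ (spatialTop (PriestleyDual L)) (spatialUp a) ↔ IsCompactElt a := by
  let _ := spatialTop (PriestleyDual L)
  constructor
  · intro h S hS
    obtain ⟨T, hTS, hT, haT⟩ := h.elim_finite_subcover_image (b := S) (c := spatialUp)
      (fun s _ => isOpen_spatialTop_iff.2 ⟨s, rfl⟩) fun y hy => by
        obtain ⟨s, hs, hys⟩ := mem_spatialUp_sSup.1 ((spatialUp_subset_iff hL).2 hS hy)
        exact mem_iUnion₂.2 ⟨s, hs, hys⟩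
    refine ⟨T, hTS, hT, (spatialUp_subset_iff hL).1 fun y hy => mem_spatialUp_sSup.2 ?_⟩
    simpa using haT hy
  · intro h
    refine isCompact_of_finite_subcover fun {ι} U hU haU => ?_
    choose c hc using fun i => isOpen_spatialTop_iff.1 (hU i)
    obtain ⟨T, hTS, hT, haT⟩ := h (range c) <| (spatialUp_subset_iff hL).1 fun y hy => by
      obtain ⟨i, hi⟩ := mem_iUnion.1 (haU hy)
      exact mem_spatialUp_sSup.2 ⟨c i, ⟨i, rfl⟩, hc i ▸ hi⟩
    rw [← image_univ] at hTS
    obtain ⟨I, -, hI, haI⟩ :=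
      (exists_subset_image_finite_and (p := fun T => a ≤ sSup T)).1 ⟨T, hTS, hT, haT⟩
    refine ⟨hI.toFinset, fun y hy => ?_⟩
    obtain ⟨_, ⟨i, hi, rfl⟩, hyi⟩ := mem_spatialUp_sSup.1 ((spatialUp_subset_iff hL).2 haI hy)
    exact mem_iUnion₂.2 ⟨i, by simpa using hi, hc i ▸ hyi⟩

theorem compactlyBased_spatialPart (hL : AlgebraicFrame L) :
    @CompactlyBased (spatialPart (PriestleyDual L)) (spatialTop (PriestleyDual L)) := by
  intro V hV y hy
  obtain ⟨a, rfl⟩ := isOpen_spatialTop_iff.1 hV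
  rw [hL a, mem_spatialUp_sSup] at hy
  obtain ⟨k, ⟨hk, hka⟩, hyk⟩ := hy
  exact ⟨spatialUp k, isOpen_spatialTop_iff.2 ⟨k, rfl⟩, (isCompact_spatialUp_iff hL).2 hk, hyk,
    (spatialUp_subset_iff hL).2 hka⟩

theorem t0Space_spatialPart :
    @T0Space (spatialPart (PriestleyDual L)) (spatialTop (PriestleyDual L)) := by
  let _ := spatialTop (PriestleyDual L)
  refine ⟨fun x y hxy => Subtype.ext (Subtype.ext (ext fun a => ?_))⟩
  exact hxy.mem_open_iff (isOpen_spatialTop_iff.2 ⟨a, rfl⟩)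

theorem quasiSober_spatialPart :
    @QuasiSober (spatialPart (PriestleyDual L)) (spatialTop (PriestleyDual L)) := by
  let _ := spatialTop (PriestleyDual L)
  refine ⟨fun {C} hC hCc => ?_⟩
  have hopen : ∀ a : L, IsOpen (spatialUp a) := fun a => isOpen_spatialTop_iff.2 ⟨a, rfl⟩
  let y := spatialPoint {a : L | (C ∩ spatialUp a).Nonempty} ⟨?_, ?_, ?_, ?_, ?_⟩
  · refine ⟨y, Subset.antisymm (closure_minimal (singleton_subset_iff.2 ?_) hCc) fun z hz => ?_⟩
    · by_contra hy
      obtain ⟨a, ha⟩ := isOpen_spatialTop_iff.1 hCc.isOpen_compl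
      obtain ⟨z, hzC, hza⟩ : (C ∩ spatialUp a).Nonempty :=
        (ha ▸ hy : y ∈ spatialUp a)
      exact (ha ▸ hza : z ∈ Cᶜ) hzC
    · refine mem_closure_iff.2 fun O hO hzO => ?_
      obtain ⟨a, rfl⟩ := isOpen_spatialTop_iff.1 hO
      exact ⟨y, show (C ∩ spatialUp a).Nonempty from ⟨z, hz, hzO⟩, rfl⟩
  · obtain ⟨z, hz⟩ := hC.1
    exact ⟨⊤, z, hz, top_mem z.1⟩
  · intro h
    obtain ⟨z, _, hz⟩ : (⊥ : L) ∈ {a : L | (C ∩ spatialUp a).Nonempty} := h ▸ mem_univ _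
    exact bot_notMem z.1 hz
  · rintro a ⟨z, hzC, hz⟩ b hab
    exact ⟨z, hzC, mem_of_le z.1 hz hab⟩
  · intro a ha b hb
    rw [mem_ofPred_eq, spatialUp_inf]
    exact hC.2 _ _ (hopen a) (hopen b) ha hb
  · rintro S ⟨z, hzC, hz⟩
    obtain ⟨s, hs, hzs⟩ := mem_spatialUp_sSup.1 hz
    exact ⟨s, hs, z, hzC, hzs⟩

theorem arithmeticFrame_iff_kerSet_inter (hL : AlgebraicFrame L) :
    ArithmeticFrame L ↔ ∀ U ∈ ClopUp (PriestleyDual L), ∀ V ∈ ClopUp (PriestleyDual L),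
      kerSet (PriestleyDual L) (U ∩ V) =
        kerSet (PriestleyDual L) U ∩ kerSet (PriestleyDual L) V := by
  constructor
  · intro h U hU V hV
    obtain ⟨b, rfl⟩ := mem_clopUp_iff.1 hU
    obtain ⟨c, rfl⟩ := mem_clopUp_iff.1 hV
    ext x
    rw [← basicUp_inf, mem_inter_iff]
    simp only [mem_kerSet_basicUp_iff]
    constructor
    · rintro ⟨a, hax, ha⟩
      exact ⟨⟨a, hax, ha.mono le_rfl inf_le_left⟩, a, hax, ha.mono le_rfl inf_le_right⟩
    · rintro ⟨⟨a, hax, hab⟩, a', hax', hac⟩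
      exact ⟨a ⊓ a', (inf_mem_iff x).2 ⟨hax, hax'⟩,
        h.2 _ _ _ (hab.mono inf_le_left le_rfl) (hac.mono inf_le_right le_rfl)⟩
  · refine fun h => ⟨hL, fun a b c hab hac => ?_⟩
    have hker := h _ (basicUp_mem_clopUp b) _ (basicUp_mem_clopUp c)
    rw [← basicUp_inf] at hker
    obtain ⟨T, hTS, hT, haT⟩ :=
      exists_finite_of_basicUp_subset (a := a) (S := {d | frameWayBelow d (b ⊓ c)}) fun x hx => by
        have hx' : x ∈ kerSet (PriestleyDual L) (basicUp (b ⊓ c)) := by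
          rw [hker]
          exact ⟨mem_kerSet_basicUp_iff.2 ⟨a, hx, hab⟩, mem_kerSet_basicUp_iff.2 ⟨a, hx, hac⟩⟩
        obtain ⟨d, hdx, hd⟩ := mem_kerSet_basicUp_iff.1 hx'
        exact mem_iUnion₂.2 ⟨d, hd, hdx⟩
    exact (frameWayBelow.sSup_of_finite hT hTS).mono haT le_rfl

theorem arithmeticFrame_iff_stablyCompactlyBased (hL : AlgebraicFrame L) :
    ArithmeticFrame L ↔
      @CompactlyBased (spatialPart (PriestleyDual L)) (spatialTop (PriestleyDual L)) ∧
        @T0Space (spatialPart (PriestleyDual L)) (spatialTop (PriestleyDual L)) ∧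
        @QuasiSober (spatialPart (PriestleyDual L)) (spatialTop (PriestleyDual L)) ∧
        ∀ U V : Set (spatialPart (PriestleyDual L)),
          @IsCompact _ (spatialTop (PriestleyDual L)) U →
          IsOpen[spatialTop (PriestleyDual L)] U →
          @IsCompact _ (spatialTop (PriestleyDual L)) V →
          IsOpen[spatialTop (PriestleyDual L)] V →
          @IsCompact _ (spatialTop (PriestleyDual L)) (U ∩ V) := by
  rw [hL.arithmeticFrame_iff]
  constructor
  · refine fun h => ⟨compactlyBased_spatialPart hL, t0Space_spatialPart,
      quasiSober_spatialPart, fun U V hU hUo hV hVo => ?_⟩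
    obtain ⟨a, rfl⟩ := isOpen_spatialTop_iff.1 hUo
    obtain ⟨b, rfl⟩ := isOpen_spatialTop_iff.1 hVo
    rw [← spatialUp_inf]
    rw [isCompact_spatialUp_iff hL] at hU hV ⊢
    exact h a b hU hV
  · rintro ⟨-, -, -, h⟩ k l hk hl
    rw [← isCompact_spatialUp_iff hL] at hk hl ⊢
    rw [spatialUp_inf]
    exact h _ _ hk (isOpen_spatialTop_iff.2 ⟨k, rfl⟩) hl (isOpen_spatialTop_iff.2 ⟨l, rfl⟩)

end PriestleyDual

/-- for an algebraic frame L, TFAE: L is arithmetic; its Priestley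
space is kernel-stable; the spatial part is stably compactly based. -/
theorem stmt11 (L : Type*) [Order.Frame L] (halg : AlgebraicFrame L) :
    [ArithmeticFrame L,
      ∀ U ∈ ClopUp (PriestleyDual L), ∀ V ∈ ClopUp (PriestleyDual L),
        kerSet (PriestleyDual L) (U ∩ V) =
          kerSet (PriestleyDual L) U ∩ kerSet (PriestleyDual L) V,
      @CompactlyBased (spatialPart (PriestleyDual L)) (spatialTop (PriestleyDual L)) ∧
        @T0Space (spatialPart (PriestleyDual L)) (spatialTop (PriestleyDual L)) ∧
        @QuasiSober (spatialPart (PriestleyDual L)) (spatialTop (PriestleyDual L)) ∧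
        ∀ U V : Set (spatialPart (PriestleyDual L)),
          @IsCompact _ (spatialTop (PriestleyDual L)) U →
          IsOpen[spatialTop (PriestleyDual L)] U →
          @IsCompact _ (spatialTop (PriestleyDual L)) V →
          IsOpen[spatialTop (PriestleyDual L)] V →
          @IsCompact _ (spatialTop (PriestleyDual L)) (U ∩ V)].TFAE := by
  tfae_have 1 ↔ 2 := PriestleyDual.arithmeticFrame_iff_kerSet_inter halg
  tfae_have 1 ↔ 3 := PriestleyDual.arithmeticFrame_iff_stablyCompactlyBased halg
  tfae_finish
end
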